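/- arXiv:2102.01371 — 7 statements merged into one kernel-verified Lean document; each statement's English description precedes it below -/
import Mathlib

section
/- Let α ∈ (1,2) and write g_k = g^{(α)}_k. Then g_0 = 1, g_1 = −α < 0, for every integer k ≥ 2 one has g_k > g_{k+1} > 0, for every integer n ≥ 1 the partial sum Σ_{k=0}^{n} g_k is strictly negative, and the series Σ_{k=0}^{∞} g_k converges with sum 0. -/
/-- Grünwald–Letnikov coefficients: `g 0 = 1`, `g k = (1 - (α+1)/k) * g (k-1)` for `k ≥ 1`. -/
noncomputable def glCoef (α : ℝ) : ℕ → ℝ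
  | 0 => 1
  | k + 1 => (1 - (α + 1) / ((k : ℝ) + 1)) * glCoef α k

open Filter Topology in
/-- A real sequence that is eventually nonnegative sums to the limit of its partial sums. -/
theorem hasSum_of_tendsto_sum_range_of_nonneg_add {f : ℕ → ℝ} {a : ℝ} (m : ℕ)
    (hf : ∀ k, 0 ≤ f (k + m))
    (h : Tendsto (fun n ↦ ∑ k ∈ Finset.range n, f k) atTop (𝓝 a)) : HasSum f a := by
  rw [← sub_add_cancel a (∑ i ∈ Finset.range m, f i), ← hasSum_nat_add_iff (f := f) m,
    hasSum_iff_tendsto_nat_of_nonneg hf]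
  refine (((tendsto_add_atTop_iff_nat m).2 h).sub_const _).congr fun n ↦ ?_
  rw [add_comm n m, Finset.sum_range_add, add_sub_cancel_left]
  simp only [add_comm]

theorem glCoef_succ_mul (α : ℝ) (k : ℕ) :
    ((k : ℝ) + 1) * glCoef α (k + 1) = (k - α) * glCoef α k := by
  have : (k : ℝ) + 1 ≠ 0 := by positivity
  rw [glCoef]
  field_simp
  ring

theorem mul_sum_range_glCoef (α : ℝ) (n : ℕ) :
    α * ∑ k ∈ Finset.range n, glCoef α k = -(n * glCoef α n) := by
  induction n with
  | zero => simp
  | succ n ih =>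
    rw [Finset.sum_range_succ, mul_add, ih]
    push_cast
    rw [glCoef_succ_mul]
    ring

theorem glCoef_one (α : ℝ) : glCoef α 1 = -α := by
  simp [glCoef]

theorem glCoef_add_two_pos {α : ℝ} (hα : α ∈ Set.Ioo (1 : ℝ) 2) (k : ℕ) :
    0 < glCoef α (k + 2) := by
  obtain ⟨h1, h2⟩ := hα
  induction k with
  | zero =>
    have h := glCoef_succ_mul α 1
    rw [glCoef_one] at h
    norm_num at h ⊢
    nlinarith
  | succ k ih =>
    have h := glCoef_succ_mul α (k + 2)
    push_cast at h
    have hk : (0 : ℝ) < k + 2 - α := by linarith [(Nat.cast_nonneg k : (0 : ℝ) ≤ k)]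
    refine pos_of_mul_pos_right (h ▸ mul_pos hk ih) (by positivity)

theorem glCoef_add_three_lt {α : ℝ} (hα : α ∈ Set.Ioo (1 : ℝ) 2) (k : ℕ) :
    glCoef α (k + 3) < glCoef α (k + 2) := by
  have h := glCoef_succ_mul α (k + 2)
  push_cast at h
  have hpos := glCoef_add_two_pos hα k
  have hk : (0 : ℝ) < k + 2 + 1 := by positivity
  refine lt_of_mul_lt_mul_left ?_ hk.le
  rw [h]
  nlinarith [hα.1]

theorem mul_glCoef_add_two_le {α : ℝ} (hα : α ∈ Set.Ioo (1 : ℝ) 2) (k : ℕ) :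
    ((k : ℝ) + 1) * (((k : ℝ) + 2) * glCoef α (k + 2)) ≤ α * (α - 1) := by
  induction k with
  | zero =>
    have h := glCoef_succ_mul α 1
    rw [glCoef_one] at h
    norm_num at h ⊢
    linarith
  | succ k ih =>
    have h := glCoef_succ_mul α (k + 2)
    have hpos : 0 < ((k : ℝ) + 2) * glCoef α (k + 2) :=
      mul_pos (by positivity) (glCoef_add_two_pos hα k)
    push_cast at h ⊢
    have h' : ((k : ℝ) + 1 + 2) * glCoef α (k + 1 + 2) = (k + 2 - α) * glCoef α (k + 2) := by
      rw [← h]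
      ring_nf
    rw [h']
    nlinarith [hα.1]

open Filter Topology in
theorem tendsto_sum_range_glCoef {α : ℝ} (hα : α ∈ Set.Ioo (1 : ℝ) 2) :
    Tendsto (fun n ↦ ∑ k ∈ Finset.range n, glCoef α k) atTop (𝓝 0) := by
  have hα0 : α ≠ 0 := by linarith [hα.1]
  have hlim : Tendsto (fun k : ℕ ↦ ((k : ℝ) + 2) * glCoef α (k + 2)) atTop (𝓝 0) := by
    have hbound : Tendsto (fun k : ℕ ↦ α * (α - 1) * (1 / ((k : ℝ) + 1))) atTop (𝓝 0) := by
      simpa using tendsto_one_div_add_atTop_nhds_zero_nat.const_mul (α * (α - 1))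
    refine squeeze_zero (fun k ↦ (mul_pos (by positivity) (glCoef_add_two_pos hα k)).le)
      (fun k ↦ ?_) hbound
    rw [mul_one_div, le_div_iff₀' (by positivity)]
    exact mul_glCoef_add_two_le hα k
  rw [← tendsto_add_atTop_iff_nat 2]
  have hdiv := (hlim.div_const α).neg
  rw [zero_div, neg_zero] at hdiv
  refine hdiv.congr fun k ↦ ?_
  have h := mul_sum_range_glCoef α (k + 2)
  push_cast at h
  rw [← neg_div, ← h, mul_div_cancel_left₀ _ hα0]

theorem sum_range_glCoef_neg {α : ℝ} (hα : α ∈ Set.Ioo (1 : ℝ) 2) (n : ℕ) :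
    ∑ k ∈ Finset.range (n + 2), glCoef α k < 0 := by
  have h := mul_sum_range_glCoef α (n + 2)
  have hpos : 0 < ((n + 2 : ℕ) : ℝ) * glCoef α (n + 2) :=
    mul_pos (by positivity) (glCoef_add_two_pos hα n)
  refine neg_of_mul_neg_right (a := α) ?_ (by linarith [hα.1])
  linarith

theorem glCoef_properties (α : ℝ) (hα : α ∈ Set.Ioo (1 : ℝ) 2) :
    glCoef α 0 = 1 ∧
    glCoef α 1 = -α ∧ glCoef α 1 < 0 ∧
    (∀ k : ℕ, 2 ≤ k → glCoef α k > glCoef α (k + 1) ∧ glCoef α (k + 1) > 0) ∧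
    (∀ n : ℕ, 1 ≤ n → ∑ k ∈ Finset.range (n + 1), glCoef α k < 0) ∧
    HasSum (glCoef α) 0 := by
  refine ⟨rfl, glCoef_one α, ?_, fun k hk ↦ ?_, fun n hn ↦ ?_, ?_⟩
  · rw [glCoef_one]
    linarith [hα.1]
  · obtain ⟨k, rfl⟩ := Nat.exists_eq_add_of_le' hk
    exact ⟨glCoef_add_three_lt hα k, glCoef_add_two_pos hα (k + 1)⟩
  · obtain ⟨n, rfl⟩ := Nat.exists_eq_add_of_le' hn
    exact sum_range_glCoef_neg hα n
  · exact hasSum_of_tendsto_sum_range_of_nonneg_add 2 (fun k ↦ (glCoef_add_two_pos hα k).le)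
      (tendsto_sum_range_glCoef hα)
end

section
/- Let α ∈ (1,2). For every integer k ≥ 0, the Fourier cosine coefficient (1/(2π))·∫_{−π}^{π} g_α(θ)·cos(kθ) dθ equals −2g^{(α)}_1 when k = 0, equals −(g^{(α)}_0 + g^{(α)}_2) when k = 1, and equals −g^{(α)}_{k+1} when k ≥ 2. -/
open Real

/-- The generating function `g_α(θ) = -2^{α+1} (sin(|θ|/2))^α cos(α(π-|θ|)/2 + |θ|)`. -/
noncomputable def gFun (α θ : ℝ) : ℝ :=
  -(2 : ℝ) ^ (α + 1) * Real.sin (|θ| / 2) ^ α * Real.cos (α * (π - |θ|) / 2 + |θ|)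

/-- The integral of `(sin (θ/2))^α cos (α(π-θ)/2 + mθ)` over `[0, π]`. -/
noncomputable def sinRpowCosIntegral (α m : ℝ) : ℝ :=
  ∫ θ in 0..π, Real.sin (θ / 2) ^ α * Real.cos (α * (π - θ) / 2 + m * θ)

lemma continuous_sin_half_rpow_mul_cos {α : ℝ} (hα : 0 < α) (m : ℝ) :
    Continuous fun θ : ℝ => Real.sin (θ / 2) ^ α * Real.cos (α * (π - θ) / 2 + m * θ) :=
  ((by fun_prop : Continuous fun θ : ℝ => Real.sin (θ / 2)).rpow_const
    fun _ => Or.inr hα.le).mul (by fun_prop)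

lemma hasDerivAt_sin_half_rpow_mul_sin {α : ℝ} (hα : 0 < α) (m : ℝ) {θ : ℝ}
    (hθ : 0 ≤ Real.sin (θ / 2)) :
    HasDerivAt
      (fun θ : ℝ => Real.sin (θ / 2) ^ (α + 1) * Real.sin ((α + 1) * (π - θ) / 2 + m * θ))
      ((α + 1 - m) / 2 * (Real.sin (θ / 2) ^ α * Real.cos (α * (π - θ) / 2 + (m - 1) * θ)) +
        m / 2 * (Real.sin (θ / 2) ^ α * Real.cos (α * (π - θ) / 2 + m * θ))) θ := by
  have hs : HasDerivAt (fun θ : ℝ => Real.sin (θ / 2)) (Real.cos (θ / 2) * (1 / 2)) θ :=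
    ((hasDerivAt_id θ).div_const 2).sin
  have hr := hs.rpow_const (p := α + 1) (Or.inr (by linarith))
  have hl : HasDerivAt (fun θ : ℝ => (α + 1) * (π - θ) / 2 + m * θ)
      ((α + 1) * (-1) / 2 + m * 1) θ :=
    ((((hasDerivAt_id θ).const_sub π).const_mul (α + 1)).div_const 2).add
      ((hasDerivAt_id θ).const_mul m)
  refine (hr.mul hl.sin).congr_deriv ?_
  rw [Real.rpow_add_one' hθ (by linarith), add_sub_cancel_right]
  obtain ⟨B, hB⟩ : ∃ B, B = α * (π - θ) / 2 + m * θ - θ / 2 := ⟨_, rfl⟩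
  have e1 : (α + 1) * (π - θ) / 2 + m * θ = B + π / 2 := by rw [hB]; ring
  have e2 : α * (π - θ) / 2 + (m - 1) * θ = B - θ / 2 := by rw [hB]; ring
  have e3 : α * (π - θ) / 2 + m * θ = B + θ / 2 := by rw [hB]; ring
  rw [e1, e2, e3, Real.sin_add_pi_div_two, Real.cos_add_pi_div_two, Real.cos_add, Real.cos_sub]
  ring

lemma mul_sinRpowCosIntegral {α : ℝ} (hα : 0 < α) (m : ℤ) :
    m * sinRpowCosIntegral α m = (m - 1 - α) * sinRpowCosIntegral α (m - 1) := by
  have hc := fun c : ℝ => continuous_sin_half_rpow_mul_cos hα c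
  have h := intervalIntegral.integral_eq_sub_of_hasDerivAt (a := 0) (b := π)
    (fun θ hθ => hasDerivAt_sin_half_rpow_mul_sin hα m (by
      rw [Set.uIcc_of_le pi_pos.le] at hθ
      exact Real.sin_nonneg_of_nonneg_of_le_pi (by linarith [hθ.1]) (by linarith [hθ.2, pi_pos])))
    ((((hc _).const_mul _).add ((hc _).const_mul _)).intervalIntegrable _ _)
  rw [intervalIntegral.integral_add (((hc _).const_mul _).intervalIntegrable _ _)
      (((hc _).const_mul _).intervalIntegrable _ _),
    intervalIntegral.integral_const_mul, intervalIntegral.integral_const_mul] at h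
  simp only [sub_self, mul_zero, zero_div, zero_add, Real.sin_int_mul_pi, Real.sin_zero,
    Real.zero_rpow (by linarith : α + 1 ≠ 0), zero_mul] at h
  simp only [sinRpowCosIntegral]
  linarith

lemma sinRpowCosIntegral_neg {α : ℝ} (hα : 0 < α) (n : ℕ) :
    sinRpowCosIntegral α (-((n : ℝ) + 1)) = 0 := by
  induction n with
  | zero =>
    have h := mul_sinRpowCosIntegral hα 0
    push_cast at h
    rw [zero_mul, eq_comm, mul_eq_zero] at h
    rcases h with h | h
    · linarith
    · simpa using h
  | succ n ih =>
    have h := mul_sinRpowCosIntegral hα (-((n : ℤ) + 1))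
    push_cast at h
    rw [ih, mul_zero, eq_comm, mul_eq_zero] at h
    rcases h with h | h
    · have : (0 : ℝ) ≤ n := n.cast_nonneg
      linarith
    · rw [← h]
      push_cast
      ring_nf

/-- On the unit circle, `(1 - e^{iθ})^α` has real part `(2 sin (θ/2))^α cos (α(π-θ)/2)`. -/
lemma re_one_sub_exp_cpow {α : ℝ} (hα : 0 < α) {θ : ℝ} (hθ : θ ∈ Set.Icc 0 (2 * π)) :
    ((1 - Complex.exp (θ * Complex.I)) ^ (α : ℂ)).re =
      2 ^ α * (Real.sin (θ / 2) ^ α * Real.cos (α * (π - θ) / 2)) := by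
  have hs : 0 ≤ Real.sin (θ / 2) :=
    Real.sin_nonneg_of_nonneg_of_le_pi (by linarith [hθ.1]) (by linarith [hθ.2])
  have key : 1 - Complex.exp (θ * Complex.I) =
      ((2 * Real.sin (θ / 2) : ℝ) : ℂ) * Complex.exp (((θ - π) / 2 : ℝ) * Complex.I) := by
    have h1 : Complex.exp (θ * Complex.I) =
        Complex.exp ((θ / 2 : ℝ) * Complex.I) * Complex.exp ((θ / 2 : ℝ) * Complex.I) := by
      rw [← Complex.exp_add]; congr 1; push_cast; ring
    have h2 : (θ - π) / 2 = θ / 2 - π / 2 := by ring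
    rw [h1, h2]
    simp only [Complex.exp_mul_I, ← Complex.ofReal_cos, ← Complex.ofReal_sin,
      Real.cos_sub_pi_div_two, Real.sin_sub_pi_div_two]
    have h3 := Real.sin_sq_add_cos_sq (θ / 2)
    generalize Real.sin (θ / 2) = s at h3 ⊢
    generalize Real.cos (θ / 2) = c at h3 ⊢
    apply Complex.ext
    · simp
      linarith
    · simp
      ring
  rw [key, ← mul_assoc, ← Real.mul_rpow (by norm_num) hs]
  rcases hs.eq_or_lt with h0 | hpos
  · have : (α : ℂ) ≠ 0 := by exact_mod_cast hα.ne'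
    simp [← h0, Complex.zero_cpow this, Real.zero_rpow hα.ne']
  · have hr : 0 < 2 * Real.sin (θ / 2) := by linarith
    have hne : ((2 * Real.sin (θ / 2) : ℝ) : ℂ) ≠ 0 := by exact_mod_cast hr.ne'
    rw [Complex.cpow_def_of_ne_zero (mul_ne_zero hne (Complex.exp_ne_zero _)),
      Complex.log_ofReal_mul hr (Complex.exp_ne_zero _),
      Complex.log_exp (by simp; linarith [hθ.1, pi_pos]) (by simp; linarith [hθ.2, pi_pos]),
      Complex.exp_re, Real.rpow_def_of_pos hr, ← Real.cos_neg (α * (π - θ) / 2)]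
    congr 2
    · simp
    · simp; ring

lemma circleAverage_one_sub_cpow {α : ℝ} (hα : 0 < α) :
    Real.circleAverage (fun z : ℂ => (1 - z) ^ (α : ℂ)) 0 1 = 1 := by
  rw [circleAverage_of_differentiable_on_off_countable Set.countable_empty]
  · simp
  · intro z hz
    have hz' : ‖z‖ ≤ 1 := by simpa using hz
    refine (ContinuousAt.comp (f := fun z : ℂ => 1 - z) (g := fun z : ℂ => z ^ (α : ℂ))
      (Complex.continuousAt_cpow_const_of_re_pos (Or.inl ?_) (by simpa using hα))
      (by fun_prop)).continuousWithinAt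
    simpa using (Complex.re_le_norm z).trans hz'
  · intro z hz
    have hz' : ‖z‖ < 1 := by simpa using hz
    refine ((differentiableAt_const 1).sub differentiableAt_id).cpow_const (Or.inl ?_)
    simpa using (Complex.re_le_norm z).trans_lt hz'

lemma continuous_one_sub_circleMap_cpow {α : ℝ} (hα : 0 < α) :
    Continuous fun θ : ℝ => (1 - circleMap 0 1 θ) ^ (α : ℂ) := by
  refine continuous_iff_continuousAt.2 fun θ =>
    ContinuousAt.comp (f := fun θ : ℝ => 1 - circleMap 0 1 θ) (g := fun z : ℂ => z ^ (α : ℂ))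
      (Complex.continuousAt_cpow_const_of_re_pos (Or.inl ?_) (by simpa using hα))
      (by fun_prop)
  have := Complex.re_le_norm (circleMap 0 1 θ)
  simpa using this

lemma sinRpowCosIntegral_zero {α : ℝ} (hα : 0 < α) :
    2 ^ α * sinRpowCosIntegral α 0 = π := by
  have h := congrArg Complex.re (circleAverage_one_sub_cpow hα)
  rw [Real.circleAverage_def, Complex.smul_re, ← Complex.reCLM_apply,
    ← Complex.reCLM.intervalIntegral_comp_comm
      ((continuous_one_sub_circleMap_cpow hα).intervalIntegrable _ _)] at h
  rw [intervalIntegral.integral_congr (g := fun θ : ℝ =>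
    2 ^ α * (Real.sin (θ / 2) ^ α * Real.cos (α * (π - θ) / 2 + 0 * θ))) (fun θ hθ => by
      rw [Set.uIcc_of_le two_pi_pos.le] at hθ
      simpa [circleMap] using re_one_sub_exp_cpow hα hθ),
    intervalIntegral.integral_const_mul] at h
  have hc := continuous_sin_half_rpow_mul_cos hα 0
  have hsym : ∫ θ in π..2 * π, Real.sin (θ / 2) ^ α * Real.cos (α * (π - θ) / 2 + 0 * θ) =
      sinRpowCosIntegral α 0 := by
    have := intervalIntegral.integral_comp_sub_left (a := 0) (b := π)
      (fun θ : ℝ => Real.sin (θ / 2) ^ α * Real.cos (α * (π - θ) / 2 + 0 * θ)) (2 * π)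
    rw [sub_zero, show 2 * π - π = π by ring] at this
    rw [← this, sinRpowCosIntegral]
    refine intervalIntegral.integral_congr fun θ _ => ?_
    rw [show (2 * π - θ) / 2 = π - θ / 2 by ring, Real.sin_pi_sub,
      ← Real.cos_neg (α * (π - θ) / 2 + 0 * θ)]
    ring_nf
  rw [← intervalIntegral.integral_add_adjacent_intervals (hc.intervalIntegrable 0 π)
    (hc.intervalIntegrable π (2 * π)), hsym, ← sinRpowCosIntegral] at h
  have hπ := pi_pos.ne'
  simp only [smul_eq_mul, Complex.one_re] at h
  field_simp at h
  linarith

lemma sinRpowCosIntegral_natCast {α : ℝ} (hα : 0 < α) (n : ℕ) :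
    2 ^ α * sinRpowCosIntegral α n = π * glCoef α n := by
  induction n with
  | zero => simpa [glCoef] using sinRpowCosIntegral_zero hα
  | succ n ih =>
    have h := mul_sinRpowCosIntegral hα (n + 1)
    push_cast at h ⊢
    rw [add_sub_cancel_right] at h
    have hn : (n : ℝ) + 1 ≠ 0 := n.cast_add_one_ne_zero
    rw [glCoef, ← mul_right_inj' hn]
    calc _ = 2 ^ α * (((n : ℝ) + 1) * sinRpowCosIntegral α (n + 1)) := by ring
      _ = (n - α) * (2 ^ α * sinRpowCosIntegral α n) := by rw [h]; ring
      _ = _ := by rw [ih]; field_simp; ring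

lemma integral_gFun_mul_cos {α : ℝ} (hα : 0 < α) (k : ℕ) :
    ∫ θ in (-π)..π, gFun α θ * Real.cos (k * θ) =
      -2 * (2 ^ α * sinRpowCosIntegral α (1 + k) + 2 ^ α * sinRpowCosIntegral α (1 - k)) := by
  have hcont : Continuous fun θ => gFun α θ * Real.cos (k * θ) := by
    unfold gFun
    exact ((continuous_const.mul
      ((by fun_prop : Continuous fun θ : ℝ => Real.sin (|θ| / 2)).rpow_const
        fun _ => Or.inr hα.le)).mul (by fun_prop)).mul (by fun_prop)
  have hneg : ∫ θ in (-π)..0, gFun α θ * Real.cos (k * θ) =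
      ∫ θ in 0..π, gFun α θ * Real.cos (k * θ) := by
    have := intervalIntegral.integral_comp_neg (a := 0) (b := π)
      (fun θ => gFun α θ * Real.cos (k * θ))
    rw [neg_zero] at this
    rw [← this]
    simp [gFun]
  have hpos : ∫ θ in 0..π, gFun α θ * Real.cos (k * θ) =
      ∫ θ in 0..π,
        (-2 ^ α * (Real.sin (θ / 2) ^ α * Real.cos (α * (π - θ) / 2 + (1 + k) * θ)) +
        -2 ^ α * (Real.sin (θ / 2) ^ α * Real.cos (α * (π - θ) / 2 + (1 - k) * θ))) := by
    refine intervalIntegral.integral_congr fun θ hθ => ?_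
    rw [Set.uIcc_of_le pi_pos.le] at hθ
    simp only [gFun, abs_of_nonneg hθ.1]
    rw [show α * (π - θ) / 2 + (1 + k) * θ = (α * (π - θ) / 2 + θ) + k * θ by ring,
      show α * (π - θ) / 2 + (1 - k) * θ = (α * (π - θ) / 2 + θ) - k * θ by ring,
      Real.cos_add _ ((k : ℝ) * θ), Real.cos_sub, Real.rpow_add_one two_ne_zero]
    ring
  have hc := fun c : ℝ => continuous_sin_half_rpow_mul_cos hα c
  rw [← intervalIntegral.integral_add_adjacent_intervals (hcont.intervalIntegrable (-π) 0)
    (hcont.intervalIntegrable 0 π), hneg, hpos,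
    intervalIntegral.integral_add (((hc _).const_mul _).intervalIntegrable _ _)
      (((hc _).const_mul _).intervalIntegrable _ _),
    intervalIntegral.integral_const_mul, intervalIntegral.integral_const_mul,
    ← sinRpowCosIntegral, ← sinRpowCosIntegral]
  ring

theorem fourier_cosine_coeff_gFun (α : ℝ) (hα : α ∈ Set.Ioo (1 : ℝ) 2) (k : ℕ) :
    (1 / (2 * π)) * ∫ θ in (-π)..π, gFun α θ * Real.cos (k * θ) =
      if k = 0 then -2 * glCoef α 1
      else if k = 1 then -(glCoef α 0 + glCoef α 2)
      else -glCoef α (k + 1) := by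
  have h0 : 0 < α := by linarith [hα.1]
  have hπ := pi_pos.ne'
  have hnat := sinRpowCosIntegral_natCast h0 (k + 1)
  rw [integral_gFun_mul_cos h0, show (1 : ℝ) + k = ((k + 1 : ℕ) : ℝ) by push_cast; ring, hnat]
  match k with
  | 0 =>
    have h1 := sinRpowCosIntegral_natCast h0 1
    rw [Nat.cast_one] at h1
    simp only [Nat.cast_zero, sub_zero, h1, zero_add, if_true]
    field_simp
    ring
  | 1 =>
    have h1 := sinRpowCosIntegral_natCast h0 0
    rw [Nat.cast_zero] at h1
    simp only [Nat.cast_one, sub_self, h1, one_ne_zero, if_true, if_false, Nat.reduceAdd]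
    field_simp
    ring
  | n + 2 =>
    have h1 := sinRpowCosIntegral_neg h0 n
    rw [show (1 : ℝ) - ((n + 2 : ℕ) : ℝ) = -((n : ℝ) + 1) by push_cast; ring, h1,
      if_neg (by omega), if_neg (by omega)]
    field_simp
    ring
end

section
/- Let α ∈ (1,2). For every θ ∈ [−π,π] with θ ≠ 0 one has g_α(θ) > 0, (1/2)·g_α(θ) ≤ |θ|^α, and |θ|^α ≤ (π²/(−8·cos(πα/2)))·g_α(θ); that is, 1/2 ≤ |θ|^α/g_α(θ) ≤ π²/(−8·cos(πα/2)). -/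
open Real

/-- `gFun` written with the chord length `2 sin(|θ|/2)`. -/
theorem gFun_eq_chord {α θ : ℝ} (hs : 0 ≤ Real.sin (|θ| / 2)) :
    gFun α θ = 2 * (2 * Real.sin (|θ| / 2)) ^ α *
      -Real.cos (α * (π - |θ|) / 2 + |θ|) := by
  rw [gFun, Real.mul_rpow zero_le_two hs, Real.rpow_add_one two_ne_zero]
  ring

theorem gFun_pos_and_bounds (α θ : ℝ) (hα : α ∈ Set.Ioo (1 : ℝ) 2)
    (hθ : θ ∈ Set.Icc (-π) π) (hθ0 : θ ≠ 0) :
    0 < gFun α θ ∧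
    (1 / 2) * gFun α θ ≤ |θ| ^ α ∧
    |θ| ^ α ≤ (π ^ 2 / (-8 * Real.cos (π * α / 2))) * gFun α θ := by
  obtain ⟨h1, h2⟩ := hα
  have hx : 0 < |θ| := abs_pos.mpr hθ0
  have hxπ : |θ| ≤ π := abs_le.mpr hθ
  have hπ := Real.pi_pos
  have hs_upper : Real.sin (|θ| / 2) ≤ |θ| / 2 := Real.sin_le (by positivity)
  have hs_lower : 2 / π * (|θ| / 2) ≤ Real.sin (|θ| / 2) :=
    Real.mul_le_sin (by positivity) (by linarith)
  have hs : 0 < Real.sin (|θ| / 2) := lt_of_lt_of_le (by positivity) hs_lower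
  rw [gFun_eq_chord hs.le]
  generalize Real.sin (|θ| / 2) = s at *
  generalize |θ| = x at *
  have hc : 0 < -Real.cos (π * α / 2) :=
    neg_pos.mpr (Real.cos_neg_of_pi_div_two_lt_of_lt (by nlinarith) (by nlinarith))
  have hcos : Real.cos (α * (π - x) / 2 + x) ≤ Real.cos (π * α / 2) :=
    Real.cos_le_cos_of_nonneg_of_le_pi (by positivity) (by nlinarith) (by nlinarith)
  have hcos_one := Real.neg_one_le_cos (α * (π - x) / 2 + x)
  generalize Real.cos (α * (π - x) / 2 + x) = d at *
  generalize Real.cos (π * α / 2) = c at *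
  have hp : 0 < (2 * s) ^ α := by positivity
  have hp_upper : (2 * s) ^ α ≤ x ^ α :=
    Real.rpow_le_rpow (by positivity) (by linarith) (by linarith)
  have hp_lower : x ^ α ≤ (π / 2) ^ 2 * (2 * s) ^ α := by
    have hxs : x ≤ π / 2 * (2 * s) := by
      calc x = π * (2 / π * (x / 2)) := by field_simp
        _ ≤ π * s := by gcongr
        _ = π / 2 * (2 * s) := by ring
    calc x ^ α ≤ (π / 2 * (2 * s)) ^ α := Real.rpow_le_rpow hx.le hxs (by linarith)
      _ = (π / 2) ^ α * (2 * s) ^ α := Real.mul_rpow (by positivity) (by positivity)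
      _ ≤ (π / 2) ^ (2 : ℝ) * (2 * s) ^ α := by
        gcongr
        linarith [Real.two_le_pi]
      _ = (π / 2) ^ 2 * (2 * s) ^ α := by rw [Real.rpow_two]
  refine ⟨mul_pos (by positivity) (by linarith), by nlinarith, ?_⟩
  rw [div_mul_eq_mul_div, le_div_iff₀ (by linarith)]
  calc x ^ α * (-8 * c) ≤ (π / 2) ^ 2 * (2 * s) ^ α * (-8 * d) :=
        mul_le_mul hp_lower (by linarith) (by linarith) (by positivity)
    _ = π ^ 2 * (2 * (2 * s) ^ α * -d) := by ring
end

section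
/- Let α ∈ (1,2) and n ≥ 1 an integer, and let p_{ij} denote the (i,j) entry of τ(G_n^{(α)}) for 1 ≤ i,j ≤ n. Then p_{ii} > 0 for every i, and p_{ij} < 0 for all i ≠ j. -/
/-- First-column entries of `G_n^{(α)}`: `t_0 = -2g_1`, `t_1 = -(g_0+g_2)`, `t_k = -g_{k+1}` for `k ≥ 2`. -/
noncomputable def tC (α : ℝ) : ℕ → ℝ
  | 0 => -2 * glCoef α 1
  | 1 => -(glCoef α 0 + glCoef α 2)
  | k + 2 => -glCoef α (k + 3)

/-- Padded coefficients: `t_k` for `k < n`, `0` for `k ≥ n`. -/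
noncomputable def tpad (n : ℕ) (t : ℕ → ℝ) (k : ℕ) : ℝ := if k < n then t k else 0

/-- The `n×n` symmetric Toeplitz matrix with `(i,j)` entry `t_{|i-j|}`. -/
noncomputable def toeplitzM (n : ℕ) (t : ℕ → ℝ) : Matrix (Fin n) (Fin n) ℝ :=
  fun i j => t (Nat.dist i.val j.val)

/-- The Hankel matrix `(H_n)_{ij} = t_{i+j} + t_{2(n+1)-(i+j)}` (1-based indices,
with the convention `t_k = 0` for `k ≥ n`). Here `i j : Fin n` are 0-based. -/
noncomputable def hankelM (n : ℕ) (t : ℕ → ℝ) : Matrix (Fin n) (Fin n) ℝ :=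
  fun i j => tpad n t (i.val + j.val + 2) + tpad n t (2 * n - (i.val + j.val))

/-- The τ-matrix `τ(T_n) = T_n - H_n`. -/
noncomputable def tauM (n : ℕ) (t : ℕ → ℝ) : Matrix (Fin n) (Fin n) ℝ :=
  toeplitzM n t - hankelM n t

/-- The matrix `G_n^{(α)}`. -/
noncomputable def Gmat (α : ℝ) (n : ℕ) : Matrix (Fin n) (Fin n) ℝ := toeplitzM n (tC α)

theorem glCoef_pos_of_two_le {α : ℝ} (hα : α ∈ Set.Ioo (1 : ℝ) 2) {k : ℕ} (hk : 2 ≤ k) :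
    0 < glCoef α k := by
  obtain ⟨h1, h2⟩ := hα
  induction k, hk using Nat.le_induction with
  | base =>
    simp only [glCoef]
    norm_num
    nlinarith
  | succ k hk ih =>
    have hk' : (2 : ℝ) ≤ k := by exact_mod_cast hk
    rw [glCoef]
    refine mul_pos ?_ ih
    rw [sub_pos, div_lt_one (by linarith)]
    linarith

theorem glCoef_succ_lt {α : ℝ} (hα : α ∈ Set.Ioo (1 : ℝ) 2) {k : ℕ} (hk : 2 ≤ k) :
    glCoef α (k + 1) < glCoef α k := by
  have hpos := glCoef_pos_of_two_le hα hk
  have hq : 0 < (α + 1) / ((k : ℝ) + 1) := by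
    have := hα.1
    positivity
  rw [glCoef]
  nlinarith [mul_pos hq hpos]

theorem tC_succ_neg {α : ℝ} (hα : α ∈ Set.Ioo (1 : ℝ) 2) (k : ℕ) : tC α (k + 1) < 0 := by
  cases k with
  | zero =>
    have := glCoef_pos_of_two_le hα le_rfl
    simp only [tC, glCoef.eq_1]
    linarith
  | succ k => exact neg_neg_of_pos (glCoef_pos_of_two_le hα (by omega))

theorem strictMono_tC_succ {α : ℝ} (hα : α ∈ Set.Ioo (1 : ℝ) 2) :
    StrictMono fun k => tC α (k + 1) := by
  refine strictMono_nat_of_lt_succ fun k => ?_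
  cases k with
  | zero =>
    have := glCoef_succ_lt hα le_rfl
    simp only [tC, glCoef.eq_1]
    linarith
  | succ k => exact neg_lt_neg (glCoef_succ_lt hα (by omega))

theorem tC_lt_tC {α : ℝ} (hα : α ∈ Set.Ioo (1 : ℝ) 2) {k m : ℕ} (hk : 1 ≤ k) (hkm : k < m) :
    tC α k < tC α m := by
  obtain ⟨k, rfl⟩ := Nat.exists_eq_add_of_le' hk
  obtain ⟨m, rfl⟩ := Nat.exists_eq_add_of_le' (hk.trans hkm.le)
  exact strictMono_tC_succ hα (by omega)

theorem tpad_tC_nonpos {α : ℝ} (hα : α ∈ Set.Ioo (1 : ℝ) 2) (n : ℕ) {k : ℕ} (hk : 1 ≤ k) :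
    tpad n (tC α) k ≤ 0 := by
  obtain ⟨k, rfl⟩ := Nat.exists_eq_add_of_le' hk
  unfold tpad
  split_ifs
  exacts [(tC_succ_neg hα k).le, le_rfl]

theorem tau_G_entries_sign (α : ℝ) (hα : α ∈ Set.Ioo (1 : ℝ) 2) (n : ℕ) (hn : 1 ≤ n) :
    (∀ i : Fin n, 0 < tauM n (tC α) i i) ∧
    (∀ i j : Fin n, i ≠ j → tauM n (tC α) i j < 0) := by
  refine ⟨fun i => ?_, fun i j hij => ?_⟩
  · have hi := i.isLt
    have h0 : tC α 0 = 2 * α := by simp [tC, glCoef]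
    have hs := tpad_tC_nonpos hα n (k := i.val + i.val + 2) (by omega)
    have hs' := tpad_tC_nonpos hα n (k := 2 * n - (i.val + i.val)) (by omega)
    simp only [tauM, toeplitzM, hankelM, Matrix.sub_apply, Nat.dist_self, h0]
    linarith [hα.1]
  · have hi := i.isLt
    have hj := j.isLt
    have hne : i.val ≠ j.val := Fin.val_ne_of_ne hij
    have hd : 1 ≤ Nat.dist i.val j.val := Nat.dist_pos_of_ne hne
    have hs : Nat.dist i.val j.val < i.val + j.val + 2 := by unfold Nat.dist; omega
    have hs' : Nat.dist i.val j.val < 2 * n - (i.val + j.val) := by unfold Nat.dist; omega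
    have hlt := tC_lt_tC hα hd hs
    have hlt' := tC_lt_tC hα hd hs'
    have hneg : tC α (Nat.dist i.val j.val) < 0 :=
      hlt.trans (tC_succ_neg hα (i.val + j.val + 1))
    simp only [tauM, toeplitzM, hankelM, Matrix.sub_apply, tpad]
    split_ifs
    · omega
    all_goals linarith
end

section
/- Let α ∈ (1,2) and n ≥ 1 an integer. If λ ∈ ℝ and z ∈ ℝⁿ is a nonzero vector such that G_n^{(α)}·z = λ·τ(G_n^{(α)})·z, then 1/2 < λ < 3/2; that is, all eigenvalues of τ(G_n^{(α)})^{−1}·G_n^{(α)} lie in the open interval (1/2, 3/2). -/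
/-- A quadratic form is positive when its matrix is dominated by a symmetric matrix with
positive row sums. -/
theorem dotProduct_mulVec_pos_of_dominated {ι : Type*} [Fintype ι] {M C : Matrix ι ι ℝ}
    (hsymm : ∀ i j, C i j = C j i) (hrow : ∀ i, 0 < ∑ j, C i j)
    (hdiag : ∀ i, C i i ≤ M i i) (hoff : ∀ i j, i ≠ j → |M i j| ≤ -C i j)
    {z : ι → ℝ} (hz : z ≠ 0) : 0 < z ⬝ᵥ M.mulVec z := by
  have hterm : ∀ i j, C i j * z i ^ 2 / 2 + C i j * z j ^ 2 / 2 ≤ z i * (M i j * z j) := by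
    intro i j
    rcases eq_or_ne i j with rfl | hij
    · nlinarith [mul_le_mul_of_nonneg_right (hdiag i) (sq_nonneg (z i))]
    · obtain ⟨h1, h2⟩ := abs_le.mp (hoff i j hij)
      nlinarith [mul_nonneg (sub_nonneg.mpr h1) (sq_nonneg (z i + z j)),
        mul_nonneg (sub_nonneg.mpr h2) (sq_nonneg (z i - z j))]
  have hsum : ∑ i, ∑ j, (C i j * z i ^ 2 / 2 + C i j * z j ^ 2 / 2)
      = ∑ i, (∑ j, C i j) * z i ^ 2 := by
    have hswap : ∑ i, ∑ j, C i j * z j ^ 2 / 2 = ∑ i, ∑ j, C i j * z i ^ 2 / 2 := by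
      rw [Finset.sum_comm]
      exact Finset.sum_congr rfl fun i _ => Finset.sum_congr rfl fun j _ => by rw [hsymm]
    simp only [Finset.sum_add_distrib]
    rw [hswap, ← Finset.sum_add_distrib]
    refine Finset.sum_congr rfl fun i _ => ?_
    rw [← Finset.sum_add_distrib, Finset.sum_mul]
    exact Finset.sum_congr rfl fun j _ => by ring
  calc 0 < ∑ i, (∑ j, C i j) * z i ^ 2 := by
        obtain ⟨i, hi⟩ := Function.ne_iff.mp hz
        exact Finset.sum_pos' (fun j _ => mul_nonneg (hrow j).le (sq_nonneg _))
          ⟨i, Finset.mem_univ i, mul_pos (hrow i) (sq_pos_of_ne_zero hi)⟩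
    _ ≤ z ⬝ᵥ M.mulVec z := by
        rw [← hsum]
        simp only [dotProduct, Matrix.mulVec, Finset.mul_sum]
        exact Finset.sum_le_sum fun i _ => Finset.sum_le_sum fun j _ => hterm i j

theorem tpad_nonpos {n : ℕ} {t : ℕ → ℝ} (hneg : ∀ k, t (k + 1) ≤ 0) {k : ℕ} (hk : 1 ≤ k) :
    tpad n t k ≤ 0 := by
  obtain ⟨m, rfl⟩ := Nat.exists_eq_add_of_le' hk
  unfold tpad
  split_ifs
  · exact hneg m
  · exact le_rfl

theorem le_tpad {n : ℕ} {t : ℕ → ℝ} (hneg : ∀ k, t (k + 1) ≤ 0) (k : ℕ) :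
    t (k + 1) ≤ tpad n t (k + 1) := by
  unfold tpad
  split_ifs
  · exact le_rfl
  · exact hneg k

theorem hankelM_nonpos {n : ℕ} {t : ℕ → ℝ} (hneg : ∀ k, t (k + 1) ≤ 0) (i j : Fin n) :
    hankelM n t i j ≤ 0 :=
  add_nonpos (tpad_nonpos hneg (by omega)) (tpad_nonpos hneg (by omega))

theorem toeplitzM_le_hankelM {n : ℕ} {t : ℕ → ℝ} (hneg : ∀ k, t (k + 1) ≤ 0)
    (hmono : Monotone fun k => t (k + 1)) {i j : Fin n} (hij : i ≠ j) :
    toeplitzM n t i j ≤ hankelM n t i j := by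
  have hij' : i.val ≠ j.val := fun h => hij (Fin.ext h)
  have hle : ∀ a b : ℕ, 1 ≤ a → a ≤ b → t a ≤ t b := by
    intro a b ha hab
    obtain ⟨a, rfl⟩ := Nat.exists_eq_add_of_le' ha
    obtain ⟨b, rfl⟩ := Nat.exists_eq_add_of_le' (ha.trans hab)
    exact hmono (by omega : a ≤ b)
  have hd : 1 ≤ Nat.dist i.val j.val := by unfold Nat.dist; omega
  have hd1 : Nat.dist i.val j.val ≤ i.val + j.val + 2 := by unfold Nat.dist; omega
  have hd2 : Nat.dist i.val j.val ≤ 2 * n - (i.val + j.val) := by unfold Nat.dist; omega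
  have hd0 : t (Nat.dist i.val j.val) ≤ 0 := by
    obtain ⟨a, ha⟩ := Nat.exists_eq_add_of_le' hd
    rw [ha]
    exact hneg a
  unfold toeplitzM hankelM tpad
  split_ifs
  · omega
  · simpa using hle _ _ hd hd1
  · simpa using hle _ _ hd hd2
  · simpa using hd0

theorem toeplitzM_comm (n : ℕ) (t : ℕ → ℝ) (i j : Fin n) :
    toeplitzM n t i j = toeplitzM n t j i := by
  simp only [toeplitzM, Nat.dist_comm]

theorem hankelM_comm (n : ℕ) (t : ℕ → ℝ) (i j : Fin n) :
    hankelM n t i j = hankelM n t j i := by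
  simp only [hankelM, Nat.add_comm i.val j.val]

theorem sum_toeplitzM (n : ℕ) (t : ℕ → ℝ) (i : Fin n) :
    ∑ j, toeplitzM n t i j = t 0 + ∑ k ∈ Finset.range i, t (k + 1)
      + ∑ k ∈ Finset.range (n - 1 - i), t (k + 1) := by
  obtain ⟨i, hi⟩ := i
  obtain ⟨r, rfl⟩ := Nat.exists_eq_add_of_le (Nat.succ_le_of_lt hi)
  simp only [toeplitzM]
  rw [Fin.sum_univ_eq_sum_range (fun j => t (Nat.dist i j)), Finset.sum_range_add,
    Finset.sum_range_succ, ← Finset.sum_range_reflect]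
  have h1 : ∑ j ∈ Finset.range i, t (Nat.dist i (i - 1 - j))
      = ∑ k ∈ Finset.range i, t (k + 1) := by
    refine Finset.sum_congr rfl fun j hj => congrArg t ?_
    have := Finset.mem_range.mp hj
    unfold Nat.dist
    omega
  have h2 : ∑ j ∈ Finset.range r, t (Nat.dist i (i.succ + j))
      = ∑ k ∈ Finset.range r, t (k + 1) := by
    refine Finset.sum_congr rfl fun j _ => congrArg t ?_
    unfold Nat.dist
    omega
  rw [h1, h2, Nat.dist_self, show i.succ + r - 1 - i = r by omega]
  ring

theorem sum_hankelM (n : ℕ) (t : ℕ → ℝ) (i : Fin n) :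
    ∑ j, hankelM n t i j = ∑ j ∈ Finset.range n, tpad n t (i + 1 + j + 1)
      + ∑ j ∈ Finset.range n, tpad n t (n - 1 - i + 1 + j + 1) := by
  simp only [hankelM]
  rw [Fin.sum_univ_eq_sum_range (fun j => tpad n t (i + j + 2) + tpad n t (2 * n - (i + j))),
    Finset.sum_add_distrib]
  congr 1
  · exact Finset.sum_congr rfl fun j _ => congrArg _ (by omega)
  · rw [← Finset.sum_range_reflect]
    refine Finset.sum_congr rfl fun j hj => congrArg _ ?_
    have := Finset.mem_range.mp hj
    omega

theorem sum_toeplitzM_add_hankelM_pos {n : ℕ} {t : ℕ → ℝ} (hneg : ∀ k, t (k + 1) ≤ 0)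
    (hpos : ∀ m, 0 < t 0 / 2 + ∑ k ∈ Finset.range m, t (k + 1)) (i : Fin n) :
    0 < ∑ j, (toeplitzM n t + hankelM n t) i j := by
  have hhalf : ∀ q, 0 < t 0 / 2 + ∑ k ∈ Finset.range q, t (k + 1)
      + ∑ j ∈ Finset.range n, tpad n t (q + 1 + j + 1) := by
    intro q
    have h := hpos (q + 1 + n)
    rw [Finset.sum_range_add, Finset.sum_range_succ] at h
    have h' : ∑ j ∈ Finset.range n, t (q + 1 + j + 1)
        ≤ ∑ j ∈ Finset.range n, tpad n t (q + 1 + j + 1) :=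
      Finset.sum_le_sum fun j _ => le_tpad hneg _
    linarith [hneg q]
  simp only [Matrix.add_apply, Finset.sum_add_distrib]
  rw [sum_toeplitzM, sum_hankelM]
  linarith [hhalf i, hhalf (n - 1 - i)]

/-- Generalized eigenvalues of a Toeplitz matrix relative to its τ-matrix, when the off-diagonal
coefficients are nonpositive and increasing, with strictly dominant diagonal. -/
theorem toeplitzM_tauM_spectrum {n : ℕ} {t : ℕ → ℝ} (hneg : ∀ k, t (k + 1) ≤ 0)
    (hmono : Monotone fun k => t (k + 1))
    (hpos : ∀ m, 0 < t 0 / 2 + ∑ k ∈ Finset.range m, t (k + 1))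
    {lam : ℝ} {z : Fin n → ℝ} (hz : z ≠ 0)
    (h : (toeplitzM n t).mulVec z = lam • (tauM n t).mulVec z) :
    1 / 2 < lam ∧ lam < 3 / 2 := by
  have hsymm : ∀ i j, (toeplitzM n t + hankelM n t) i j = (toeplitzM n t + hankelM n t) j i := by
    intro i j
    simp only [Matrix.add_apply, toeplitzM_comm n t i j, hankelM_comm n t i j]
  have hrow := sum_toeplitzM_add_hankelM_pos (n := n) hneg hpos
  have hplus : 0 < z ⬝ᵥ (toeplitzM n t + hankelM n t).mulVec z := by
    refine dotProduct_mulVec_pos_of_dominated hsymm hrow (fun i => le_rfl) ?_ hz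
    intro i j hij
    have h1 := toeplitzM_le_hankelM hneg hmono hij
    have h2 := hankelM_nonpos hneg i j
    rw [Matrix.add_apply, abs_of_nonpos (by linarith)]
  have hminus : 0 < z ⬝ᵥ (toeplitzM n t - (3 : ℝ) • hankelM n t).mulVec z := by
    refine dotProduct_mulVec_pos_of_dominated hsymm hrow ?_ ?_ hz
    · intro i
      have h2 := hankelM_nonpos hneg i i
      simp only [Matrix.add_apply, Matrix.sub_apply, Matrix.smul_apply, smul_eq_mul]
      linarith
    · intro i j hij
      have h1 := toeplitzM_le_hankelM hneg hmono hij
      have h2 := hankelM_nonpos hneg i j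
      simp only [Matrix.add_apply, Matrix.sub_apply, Matrix.smul_apply, smul_eq_mul]
      rw [abs_le]
      constructor <;> linarith
  have hquad := congrArg (z ⬝ᵥ ·) h
  simp only [tauM, Matrix.sub_mulVec, Matrix.add_mulVec, Matrix.smul_mulVec, dotProduct_add,
    dotProduct_sub, dotProduct_smul, smul_eq_mul] at hplus hminus hquad
  generalize z ⬝ᵥ (toeplitzM n t).mulVec z = G at *
  generalize z ⬝ᵥ (hankelM n t).mulVec z = H at *
  constructor <;> nlinarith

theorem glCoef_succ (α : ℝ) (k : ℕ) :
    glCoef α (k + 1) = (1 - (α + 1) / ((k : ℝ) + 1)) * glCoef α k := rfl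

theorem glCoef_add_three_le {α : ℝ} (hα : α ∈ Set.Ioo (1 : ℝ) 2) (k : ℕ) :
    glCoef α (k + 3) ≤ glCoef α (k + 2) := by
  rw [glCoef_succ α (k + 2)]
  refine mul_le_of_le_one_left (glCoef_add_two_pos hα k).le ?_
  have : 0 ≤ (α + 1) / (((k + 2 : ℕ) : ℝ) + 1) := div_nonneg (by linarith [hα.1]) (by positivity)
  linarith

theorem mul_sum_glCoef (α : ℝ) (m : ℕ) :
    α * ∑ k ∈ Finset.range (m + 1), glCoef α k = -((m : ℝ) + 1) * glCoef α (m + 1) := by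
  induction m with
  | zero => simp [glCoef]
  | succ m ih =>
    rw [Finset.sum_range_succ, mul_add, ih, glCoef_succ α (m + 1)]
    have : ((m + 1 : ℕ) : ℝ) + 1 ≠ 0 := by positivity
    field_simp
    push_cast
    ring

theorem tC_zero_add_sum (α : ℝ) (m : ℕ) :
    tC α 0 / 2 + ∑ k ∈ Finset.range (m + 1), tC α (k + 1)
      = -∑ k ∈ Finset.range (m + 3), glCoef α k := by
  induction m with
  | zero =>
    simp only [Finset.sum_range_succ, Finset.sum_range_zero, tC]
    ring
  | succ m ih =>
    rw [Finset.sum_range_succ, ← add_assoc, ih, Finset.sum_range_succ _ (m + 3)]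
    simp only [tC]
    ring

theorem tC_zero_add_sum_pos {α : ℝ} (hα : α ∈ Set.Ioo (1 : ℝ) 2) (m : ℕ) :
    0 < tC α 0 / 2 + ∑ k ∈ Finset.range m, tC α (k + 1) := by
  have hα0 : 0 < α := by linarith [hα.1]
  cases m with
  | zero =>
    simp only [Finset.sum_range_zero, tC, glCoef_one]
    linarith
  | succ m =>
    rw [tC_zero_add_sum]
    have h := mul_sum_glCoef α (m + 2)
    have hg : 0 < (((m + 2 : ℕ) : ℝ) + 1) * glCoef α (m + 2 + 1) :=
      mul_pos (by positivity) (glCoef_add_two_pos hα (m + 1))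
    refine pos_of_mul_pos_right (a := α) ?_ hα0.le
    linarith

theorem tC_succ_nonpos {α : ℝ} (hα : α ∈ Set.Ioo (1 : ℝ) 2) (k : ℕ) : tC α (k + 1) ≤ 0 := by
  cases k with
  | zero =>
    simp only [tC, glCoef.eq_1]
    linarith [glCoef_add_two_pos hα 0]
  | succ k =>
    simp only [tC]
    linarith [glCoef_add_two_pos hα (k + 1)]

theorem monotone_tC_succ {α : ℝ} (hα : α ∈ Set.Ioo (1 : ℝ) 2) :
    Monotone fun k => tC α (k + 1) := by
  refine monotone_nat_of_le_succ fun k => ?_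
  cases k with
  | zero =>
    simp only [tC, glCoef.eq_1]
    linarith [glCoef_add_three_le hα 0]
  | succ k =>
    simp only [tC]
    linarith [glCoef_add_three_le hα (k + 1)]

theorem tauInv_G_spectrum (α : ℝ) (hα : α ∈ Set.Ioo (1 : ℝ) 2) (n : ℕ) (hn : 1 ≤ n)
    (lam : ℝ) (z : Fin n → ℝ) (hz : z ≠ 0)
    (h : (Gmat α n).mulVec z = lam • (tauM n (tC α)).mulVec z) :
    1 / 2 < lam ∧ lam < 3 / 2 := by
  exact toeplitzM_tauM_spectrum (tC_succ_nonpos hα) (monotone_tC_succ hα)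
    (tC_zero_add_sum_pos hα) hz h
end

section
/- Let m ≥ 1 be an integer, and for each i ∈ {1,…,m} let α_i ∈ (1,2) and l_i > 0. Define q(θ) = Σ_{i=1}^m l_i·|θ_i|^{α_i} and g(θ) = Σ_{i=1}^m l_i·g_{α_i}(θ_i) for θ = (θ_1,…,θ_m) ∈ [−π,π]^m, and set c_2 = max_{1≤i≤m} π²/(−8·cos(πα_i/2)). Then for every θ ∈ [−π,π]^m with θ ≠ 0 one has (1/2)·g(θ) ≤ q(θ) ≤ c_2·g(θ). -/
open Real

theorem gFun_eq {α θ : ℝ} (hθ : |θ| ≤ π) :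
    gFun α θ = 2 * (2 * Real.sin (|θ| / 2)) ^ α *
      -Real.cos (α * (π - |θ|) / 2 + |θ|) := by
  have hs : 0 ≤ Real.sin (|θ| / 2) :=
    Real.sin_nonneg_of_nonneg_of_le_pi (by positivity) (by linarith [abs_nonneg θ])
  rw [gFun, Real.mul_rpow zero_le_two hs, Real.rpow_add_one two_ne_zero]
  ring

theorem gFun_le {α θ : ℝ} (hα : 0 ≤ α) (hθ : |θ| ≤ π) : gFun α θ ≤ 2 * |θ| ^ α := by
  have h0 := abs_nonneg θ
  have hs : 0 ≤ 2 * Real.sin (|θ| / 2) :=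
    mul_nonneg zero_le_two
      (Real.sin_nonneg_of_nonneg_of_le_pi (by positivity) (by linarith))
  have hsin : 2 * Real.sin (|θ| / 2) ≤ |θ| := by
    linarith [Real.sin_le (x := |θ| / 2) (by positivity)]
  have hpow := Real.rpow_le_rpow hs hsin hα
  have hnonneg := Real.rpow_nonneg hs α
  have hcos := Real.neg_one_le_cos (α * (π - |θ|) / 2 + |θ|)
  rw [gFun_eq hθ]
  nlinarith

theorem neg_cos_pi_mul_half_pos {α : ℝ} (hα : α ∈ Set.Ioo (1 : ℝ) 2) :
    0 < -Real.cos (π * α / 2) := by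
  have hπ := Real.pi_pos
  have h := Real.cos_neg_of_pi_div_two_lt_of_lt (x := π * α / 2)
    (by nlinarith [hα.1]) (by nlinarith [hα.2])
  linarith

theorem le_gFun {α θ : ℝ} (hα : α ∈ Set.Ioo (1 : ℝ) 2) (hθ : |θ| ≤ π) :
    2 * (2 / π * |θ|) ^ α * -Real.cos (π * α / 2) ≤ gFun α θ := by
  obtain ⟨h1, h2⟩ := hα
  have hπ := Real.pi_pos
  have h0 := abs_nonneg θ
  have hsin : 2 / π * |θ| ≤ 2 * Real.sin (|θ| / 2) := by
    linarith [Real.mul_le_sin (x := |θ| / 2) (by positivity) (by linarith)]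
  have hcos : Real.cos (α * (π - |θ|) / 2 + |θ|) ≤ Real.cos (π * α / 2) :=
    Real.cos_le_cos_of_nonneg_of_le_pi (by positivity) (by nlinarith) (by nlinarith)
  have hc := neg_cos_pi_mul_half_pos ⟨h1, h2⟩
  have hs : 0 ≤ 2 * Real.sin (|θ| / 2) := le_trans (by positivity) hsin
  rw [gFun_eq hθ]
  gcongr

theorem gFun_nonneg {α θ : ℝ} (hα : α ∈ Set.Ioo (1 : ℝ) 2) (hθ : |θ| ≤ π) :
    0 ≤ gFun α θ := by
  have hc := neg_cos_pi_mul_half_pos hα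
  have hπ := Real.pi_pos
  exact le_trans (by positivity) (le_gFun hα hθ)

theorem abs_rpow_le_mul_gFun {α θ : ℝ} (hα : α ∈ Set.Ioo (1 : ℝ) 2) (hθ : |θ| ≤ π) :
    |θ| ^ α ≤ π ^ 2 / (-8 * Real.cos (π * α / 2)) * gFun α θ := by
  have hπ := Real.pi_pos
  have hc := neg_cos_pi_mul_half_pos hα
  have h2π : (2 / π) ^ (2 : ℝ) ≤ (2 / π) ^ α :=
    Real.rpow_le_rpow_of_exponent_ge (by positivity)
      ((div_le_one hπ).2 Real.two_le_pi) hα.2.le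
  rw [Real.rpow_two] at h2π
  have hg : 2 * ((2 / π) ^ 2 * |θ| ^ α) * -Real.cos (π * α / 2) ≤ gFun α θ := by
    refine le_trans ?_ (le_gFun hα hθ)
    rw [Real.mul_rpow (by positivity) (abs_nonneg θ)]
    gcongr
  have hc8 : 0 < -8 * Real.cos (π * α / 2) := by linarith
  calc |θ| ^ α = π ^ 2 / (-8 * Real.cos (π * α / 2)) *
        (2 * ((2 / π) ^ 2 * |θ| ^ α) * -Real.cos (π * α / 2)) := by
        have hc' : Real.cos (π * α / 2) ≠ 0 := (neg_pos.1 hc).ne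
        field_simp
        norm_num
    _ ≤ _ := by gcongr

theorem q_g_equivalence (m : ℕ) (hm : 1 ≤ m) (α l : Fin m → ℝ)
    (hα : ∀ i, α i ∈ Set.Ioo (1 : ℝ) 2) (hl : ∀ i, 0 < l i)
    (θ : Fin m → ℝ) (hθ : ∀ i, θ i ∈ Set.Icc (-π) π) (hθ0 : θ ≠ 0) :
    (1 / 2) * (∑ i, l i * gFun (α i) (θ i)) ≤ ∑ i, l i * |θ i| ^ (α i) ∧
    ∑ i, l i * |θ i| ^ (α i) ≤
      (Finset.univ.sup' ⟨(⟨0, hm⟩ : Fin m), Finset.mem_univ _⟩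
          (fun i => π ^ 2 / (-8 * Real.cos (π * α i / 2)))) *
        ∑ i, l i * gFun (α i) (θ i) := by
  have habs i : |θ i| ≤ π := abs_le.2 (hθ i)
  rw [Finset.mul_sum, Finset.mul_sum]
  constructor
  · refine Finset.sum_le_sum fun i _ => ?_
    have := mul_le_mul_of_nonneg_left
      (gFun_le (zero_le_one.trans (hα i).1.le) (habs i)) (hl i).le
    linarith
  · refine Finset.sum_le_sum fun i _ => ?_
    rw [mul_left_comm]
    refine mul_le_mul_of_nonneg_left ?_ (hl i).le
    refine (abs_rpow_le_mul_gFun (hα i) (habs i)).trans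
      (mul_le_mul_of_nonneg_right ?_ (gFun_nonneg (hα i) (habs i)))
    exact Finset.le_sup' (fun i => π ^ 2 / (-8 * Real.cos (π * α i / 2))) (Finset.mem_univ i)
end

section
/- Let m ≥ 1 be an integer, and for each i ∈ {1,…,m} let α_i ∈ (1,2), l_i > 0, and n_i ≥ 1. Define q(θ) = Σ_{i=1}^m l_i·|θ_i|^{α_i} on [−π,π]^m. Let p : [−π,π]^m → ℝ be integrable, and suppose there are constants 0 < c_0 ≤ c_1 such that c_0·q(θ) ≤ p(θ) ≤ c_1·q(θ) for all θ ∈ [−π,π]^m. Let B and Q be the multilevel Toeplitz matrices (with sizes n_1,…,n_m) generated by p and by q, respectively. Then for every nonzero real vector z one has zᵀQz > 0 and c_0·zᵀQz ≤ zᵀBz ≤ c_1·zᵀQz; that is, zᵀBz/zᵀQz ∈ [c_0, c_1]. -/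
open Real Matrix

open MeasureTheory

/-- The multilevel Toeplitz matrix generated by an integrable `f` on `[-π,π]^m`:
the `(x,y)` entry is `(2π)^{-m} ∫_{[-π,π]^m} f(θ) cos(Σ_i θ_i (x_i - y_i)) dθ`. -/
noncomputable def mToeplitz {m : ℕ} (n : Fin m → ℕ) (f : (Fin m → ℝ) → ℝ) :
    Matrix ((i : Fin m) → Fin (n i)) ((i : Fin m) → Fin (n i)) ℝ :=
  fun x y => (2 * Real.pi) ^ (-(m : ℤ)) *
    ∫ θ in Set.univ.pi fun _ : Fin m => Set.Icc (-Real.pi) Real.pi,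
      f θ * Real.cos (∑ i, θ i * (((x i : ℕ) : ℝ) - ((y i : ℕ) : ℝ)))

/-- The phase `Σ_i θ_i x_i` of the Fourier mode with multi-index `x`. -/
noncomputable def phase {m : ℕ} {n : Fin m → ℕ} (θ : Fin m → ℝ) (x : (i : Fin m) → Fin (n i)) :
    ℝ :=
  ∑ i, θ i * ((x i : ℕ) : ℝ)

/-- The squared modulus of the trigonometric polynomial with real coefficients `z`. -/
noncomputable def trigSq {m : ℕ} {n : Fin m → ℕ} (z : ((i : Fin m) → Fin (n i)) → ℝ)
    (θ : Fin m → ℝ) : ℝ :=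
  (∑ x, z x * Real.cos (phase θ x)) ^ 2 + (∑ x, z x * Real.sin (phase θ x)) ^ 2

section TrigSq

variable {m : ℕ} {n : Fin m → ℕ} (z : ((i : Fin m) → Fin (n i)) → ℝ)

theorem trigSq_nonneg (θ : Fin m → ℝ) : 0 ≤ trigSq z θ := by
  unfold trigSq; positivity

theorem continuous_trigSq : Continuous (trigSq z) := by
  unfold trigSq phase; fun_prop

theorem trigSq_eq_sum (θ : Fin m → ℝ) :
    trigSq z θ = ∑ x, ∑ y, z x * z y *
      Real.cos (∑ i, θ i * (((x i : ℕ) : ℝ) - ((y i : ℕ) : ℝ))) := by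
  unfold trigSq
  rw [sq, sq, Finset.sum_mul_sum, Finset.sum_mul_sum, ← Finset.sum_add_distrib]
  refine Finset.sum_congr rfl fun x _ => ?_
  rw [← Finset.sum_add_distrib]
  refine Finset.sum_congr rfl fun y _ => ?_
  have h : ∑ i, θ i * (((x i : ℕ) : ℝ) - ((y i : ℕ) : ℝ)) = phase θ x - phase θ y := by
    simp only [phase, mul_sub, Finset.sum_sub_distrib]
  rw [h, Real.cos_sub]
  ring

theorem isCompact_box : IsCompact (Set.univ.pi fun _ : Fin m => Set.Icc (-π) π) :=
  isCompact_univ_pi fun _ => isCompact_Icc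

theorem dotProduct_mToeplitz_mulVec {f : (Fin m → ℝ) → ℝ}
    (hf : IntegrableOn f (Set.univ.pi fun _ : Fin m => Set.Icc (-π) π)) :
    z ⬝ᵥ (mToeplitz n f).mulVec z = (2 * π) ^ (-(m : ℤ)) *
      ∫ θ in Set.univ.pi fun _ : Fin m => Set.Icc (-π) π, f θ * trigSq z θ := by
  have hint (x y : (i : Fin m) → Fin (n i)) :
      IntegrableOn (fun θ => z x * z y *
        (f θ * Real.cos (∑ i, θ i * (((x i : ℕ) : ℝ) - ((y i : ℕ) : ℝ)))))
        (Set.univ.pi fun _ : Fin m => Set.Icc (-π) π) :=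
    (hf.mul_continuousOn (by fun_prop) isCompact_box).const_mul _
  have hsum (θ : Fin m → ℝ) : f θ * trigSq z θ = ∑ x, ∑ y, z x * z y *
      (f θ * Real.cos (∑ i, θ i * (((x i : ℕ) : ℝ) - ((y i : ℕ) : ℝ)))) := by
    simp only [trigSq_eq_sum, Finset.mul_sum]
    exact Finset.sum_congr rfl fun x _ => Finset.sum_congr rfl fun y _ => by ring
  simp only [hsum]
  rw [integral_finsetSum _ fun x _ => integrable_finsetSum _ fun y _ => hint x y]
  simp only [dotProduct, Matrix.mulVec, mToeplitz, Finset.mul_sum]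
  refine Finset.sum_congr rfl fun x _ => ?_
  rw [integral_finsetSum _ fun y _ => hint x y, Finset.mul_sum]
  refine Finset.sum_congr rfl fun y _ => ?_
  rw [integral_const_mul]
  ring

theorem infinite_image_exp_Ioo :
    ((fun t : ℝ => Complex.exp (t * Complex.I)) '' Set.Ioo 0 π).Infinite := by
  refine (Set.Ioo_infinite Real.pi_pos).image fun s hs t ht hst => ?_
  refine Real.injOn_cos (Set.Ioo_subset_Icc_self hs) (Set.Ioo_subset_Icc_self ht) ?_
  simpa [Complex.exp_ofReal_mul_I_re] using congrArg Complex.re hst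

variable {z}

theorem exists_trigSq_ne_zero (hz : z ≠ 0) :
    ∃ θ : Fin m → ℝ, (∀ i, θ i ∈ Set.Ioo 0 π) ∧ trigSq z θ ≠ 0 := by
  by_contra! h
  let e : ((i : Fin m) → Fin (n i)) → Fin m →₀ ℕ :=
    fun x => Finsupp.equivFunOnFinite.symm fun i => (x i : ℕ)
  have he : Function.Injective e := fun x y hxy => by
    funext i
    exact Fin.ext (by simpa [e] using DFunLike.congr_fun hxy i)
  let P : MvPolynomial (Fin m) ℂ := ∑ x, MvPolynomial.monomial (e x) (z x : ℂ)
  have hP : P = 0 := by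
    refine MvPolynomial.funext_set
      (fun _ => (fun t : ℝ => Complex.exp (t * Complex.I)) '' Set.Ioo 0 π)
      (fun _ => infinite_image_exp_Ioo) fun w hw => ?_
    choose θ hθ hw using fun i => hw i (Set.mem_univ i)
    obtain rfl : (fun i => Complex.exp (θ i * Complex.I)) = w := funext hw
    have hprod (x : (i : Fin m) → Fin (n i)) :
        (∏ i, Complex.exp (θ i * Complex.I) ^ (x i : ℕ)) =
          Complex.exp (phase θ x * Complex.I) := by
      simp only [← Complex.exp_nat_mul, ← Complex.exp_sum, phase, Complex.ofReal_sum,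
        Finset.sum_mul]
      congr 1
      refine Finset.sum_congr rfl fun i _ => ?_
      push_cast
      ring
    have hev : MvPolynomial.eval (fun i => Complex.exp (θ i * Complex.I)) P =
        ∑ x, (z x : ℂ) * Complex.exp (phase θ x * Complex.I) := by
      simp only [P, map_sum, MvPolynomial.eval_monomial, ← hprod]
      refine Finset.sum_congr rfl fun x _ => ?_
      rw [Finsupp.prod_fintype _ _ fun _ => pow_zero _]
      rfl
    have h0 := h θ hθ
    unfold trigSq at h0
    rw [add_eq_zero_iff_of_nonneg (sq_nonneg _) (sq_nonneg _), sq_eq_zero_iff,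
      sq_eq_zero_iff] at h0
    rw [hev, map_zero]
    apply Complex.ext
    · simpa [Complex.exp_ofReal_mul_I_re, Complex.exp_ofReal_mul_I_im] using h0.1
    · simpa [Complex.exp_ofReal_mul_I_re, Complex.exp_ofReal_mul_I_im] using h0.2
  refine hz (funext fun x => ?_)
  have hc : MvPolynomial.coeff (e x) P = z x := by
    simp [P, MvPolynomial.coeff_sum, MvPolynomial.coeff_monomial, he.eq_iff]
  rw [hP, MvPolynomial.coeff_zero] at hc
  exact_mod_cast hc.symm

theorem setIntegral_mul_trigSq_pos (hz : z ≠ 0) {f : (Fin m → ℝ) → ℝ} (hf : Continuous f)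
    (hf0 : ∀ θ, 0 ≤ f θ) (hfpos : ∀ θ : Fin m → ℝ, (∀ i, θ i ∈ Set.Ioo 0 π) → 0 < f θ) :
    0 < ∫ θ in Set.univ.pi fun _ : Fin m => Set.Icc (-π) π, f θ * trigSq z θ := by
  have hcont : Continuous fun θ => f θ * trigSq z θ := hf.mul (continuous_trigSq z)
  rw [setIntegral_pos_iff_support_of_nonneg_ae
    (ae_of_all _ fun θ => mul_nonneg (hf0 θ) (trigSq_nonneg z θ))
    (hcont.continuousOn.integrableOn_compact isCompact_box)]
  obtain ⟨θ, hθ, hne⟩ := exists_trigSq_ne_zero hz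
  have hopen : IsOpen (Function.support (fun θ => f θ * trigSq z θ) ∩
      Set.univ.pi fun _ : Fin m => Set.Ioo 0 π) :=
    hcont.isOpen_support.inter (isOpen_set_pi Set.finite_univ fun _ _ => isOpen_Ioo)
  refine (hopen.measure_pos volume ⟨θ, mul_ne_zero (hfpos θ hθ).ne' hne, fun i _ => hθ i⟩).trans_le
    (measure_mono (Set.inter_subset_inter_right _ (Set.pi_mono fun i _ t ht => ?_)))
  exact ⟨by linarith [ht.1, Real.pi_pos], ht.2.le⟩

theorem dotProduct_mToeplitz_mulVec_mono {f g : (Fin m → ℝ) → ℝ}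
    (hf : IntegrableOn f (Set.univ.pi fun _ : Fin m => Set.Icc (-π) π))
    (hg : IntegrableOn g (Set.univ.pi fun _ : Fin m => Set.Icc (-π) π))
    (hfg : ∀ θ : Fin m → ℝ, (∀ i, θ i ∈ Set.Icc (-π) π) → f θ ≤ g θ) :
    z ⬝ᵥ (mToeplitz n f).mulVec z ≤ z ⬝ᵥ (mToeplitz n g).mulVec z := by
  rw [dotProduct_mToeplitz_mulVec z hf, dotProduct_mToeplitz_mulVec z hg]
  refine mul_le_mul_of_nonneg_left ?_ (by positivity)
  exact setIntegral_mono_on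
    (hf.mul_continuousOn (continuous_trigSq z).continuousOn isCompact_box)
    (hg.mul_continuousOn (continuous_trigSq z).continuousOn isCompact_box)
    isCompact_box.measurableSet
    fun θ hθ => mul_le_mul_of_nonneg_right (hfg θ fun i => hθ i trivial) (trigSq_nonneg z θ)

theorem dotProduct_mToeplitz_const_mul_mulVec (c : ℝ) (f : (Fin m → ℝ) → ℝ) :
    z ⬝ᵥ (mToeplitz n fun θ => c * f θ).mulVec z = c * (z ⬝ᵥ (mToeplitz n f).mulVec z) := by
  have h : (mToeplitz n fun θ => c * f θ) = c • mToeplitz n f := by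
    ext x y
    simp only [mToeplitz, Matrix.smul_apply, smul_eq_mul, mul_assoc, integral_const_mul]
    ring
  rw [h, Matrix.smul_mulVec, dotProduct_smul, smul_eq_mul]

end TrigSq

theorem rayleigh_B_Q (m : ℕ) (hm : 1 ≤ m) (n : Fin m → ℕ) (hn : ∀ i, 1 ≤ n i)
    (α l : Fin m → ℝ) (hα : ∀ i, α i ∈ Set.Ioo (1 : ℝ) 2) (hl : ∀ i, 0 < l i)
    (p : (Fin m → ℝ) → ℝ)
    (hp : IntegrableOn p (Set.univ.pi fun _ : Fin m => Set.Icc (-π) π))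
    (c0 c1 : ℝ) (hc0 : 0 < c0) (hc01 : c0 ≤ c1)
    (hpq : ∀ θ : Fin m → ℝ, (∀ i, θ i ∈ Set.Icc (-π) π) →
      c0 * (∑ i, l i * |θ i| ^ (α i)) ≤ p θ ∧ p θ ≤ c1 * (∑ i, l i * |θ i| ^ (α i)))
    (z : ((i : Fin m) → Fin (n i)) → ℝ) (hz : z ≠ 0) :
    0 < z ⬝ᵥ (mToeplitz n (fun θ => ∑ i, l i * |θ i| ^ (α i))).mulVec z ∧
    c0 * (z ⬝ᵥ (mToeplitz n (fun θ => ∑ i, l i * |θ i| ^ (α i))).mulVec z) ≤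
      z ⬝ᵥ (mToeplitz n p).mulVec z ∧
    z ⬝ᵥ (mToeplitz n p).mulVec z ≤
      c1 * (z ⬝ᵥ (mToeplitz n (fun θ => ∑ i, l i * |θ i| ^ (α i))).mulVec z) := by
  have hq : Continuous fun θ : Fin m → ℝ => ∑ i, l i * |θ i| ^ (α i) :=
    continuous_finsetSum _ fun i _ => continuous_const.mul
      ((continuous_apply i).abs.rpow_const fun _ => Or.inr (by linarith [(hα i).1]))
  have hqi := hq.continuousOn.integrableOn_compact (μ := volume) (isCompact_box (m := m))
  refine ⟨?_, ?_, ?_⟩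
  · rw [dotProduct_mToeplitz_mulVec z hqi]
    refine mul_pos (by positivity) (setIntegral_mul_trigSq_pos hz hq (fun θ => ?_) fun θ hθ => ?_)
    · exact Finset.sum_nonneg fun i _ => mul_nonneg (hl i).le (by positivity)
    · exact Finset.sum_pos
        (fun i _ => mul_pos (hl i) (Real.rpow_pos_of_pos (abs_pos.2 (hθ i).1.ne') _))
        ⟨⟨0, hm⟩, Finset.mem_univ _⟩
  · rw [← dotProduct_mToeplitz_const_mul_mulVec]
    exact dotProduct_mToeplitz_mulVec_mono (hqi.const_mul c0) hp fun θ hθ => (hpq θ hθ).1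
  · rw [← dotProduct_mToeplitz_const_mul_mulVec]
    exact dotProduct_mToeplitz_mulVec_mono hp (hqi.const_mul c1) fun θ hθ => (hpq θ hθ).2
end
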